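/- Let A be an abelian category with exact coproducts and T an n-tilting object (satisfying conditions (i), (ii), and the generation condition that complexes X• with Hom_{D(A)}(T, X•[i]) = 0 for all i are acyclic). If L ∈ A admits a map f : L → T' to some T' ∈ Add(T) such that every morphism L → E with Ext^i_A(T,E)=0 for all i>0 factors through f, then L admits a finite coresolution 0 → L → T^0 → T^1 → ⋯ → T^n → 0 with all T^j ∈ Add(T). -/

import Mathlib

open CategoryTheory Limits

universe w w' v u

/-- `X` is a direct summand of a coproduct of copies of `T`. -/
def InAdd {A : Type u} [Category.{v} A] [Abelian A] [HasCoproducts.{v} A]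
    (T X : A) : Prop :=
  ∃ (ι : Type v) (Y : A), Nonempty ((X ⊞ Y) ≅ ∐ (fun _ : ι => T))

/-- `L ∈ L_m`: there is an exact sequence `0 → L → T^0 → ⋯ → T^m → 0` with all
`T^j ∈ Add(T)` (encoded by an `ℕ`-indexed sequence vanishing in degrees `> m`). -/
def InLm {A : Type u} [Category.{v} A] [Abelian A] [HasCoproducts.{v} A]
    (T : A) (m : ℕ) (L : A) : Prop :=
  ∃ (E : ℕ → A) (f : L ⟶ E 0) (d : ∀ i : ℕ, E i ⟶ E (i + 1))
    (hw0 : f ≫ d 0 = 0) (hw : ∀ i : ℕ, d i ≫ d (i + 1) = 0),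
    (∀ i : ℕ, i ≤ m → InAdd T (E i)) ∧
    (∀ i : ℕ, m < i → IsZero (E i)) ∧
    Mono f ∧
    (ShortComplex.mk f (d 0) hw0).Exact ∧
    (∀ i : ℕ, (ShortComplex.mk (d i) (d (i + 1)) (hw i)).Exact)

section TiltingApproximation

open Abelian DerivedCategory

section ExtPerp

variable {A : Type u} [Category.{v} A] [Abelian A] [HasExt.{w} A]

lemma subsingleton_ext_of_retract {T X Y : A} {m : ℕ} (i : X ⟶ Y) (p : Y ⟶ X) (h : i ≫ p = 𝟙 X)
    (hY : Subsingleton (Ext T Y m)) : Subsingleton (Ext T X m) := by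
  refine subsingleton_of_forall_eq 0 fun x ↦ ?_
  calc x = (x.comp (Ext.mk₀ i) (add_zero m)).comp (Ext.mk₀ p) (add_zero m) := by simp [h]
    _ = 0 := by rw [Subsingleton.elim (x.comp (Ext.mk₀ i) (add_zero m)) 0, Ext.zero_comp]

lemma subsingleton_ext_of_isZero (T : A) {X : A} (m : ℕ) (h : IsZero X) :
    Subsingleton (Ext T X m) := by
  refine subsingleton_of_forall_eq 0 fun x ↦ ?_
  calc x = x.comp (Ext.mk₀ (𝟙 X)) (add_zero m) := by simp
    _ = 0 := by simp [h.eq_of_src (𝟙 X) 0]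

/-- `E` is right orthogonal to `T`: all positive Ext-groups from `T` to `E` vanish. -/
def ExtPerp (T E : A) : Prop := ∀ i : ℕ, 0 < i → Subsingleton (Ext T E i)

namespace ExtPerp

variable {T : A}

lemma of_isZero {X : A} (h : IsZero X) : ExtPerp T X :=
  fun _ _ ↦ subsingleton_ext_of_isZero _ _ h

lemma of_retract {X Y : A} (hY : ExtPerp T Y) (i : X ⟶ Y) (p : Y ⟶ X) (h : i ≫ p = 𝟙 X) :
    ExtPerp T X :=
  fun _ hm ↦ subsingleton_ext_of_retract i p h (hY _ hm)

lemma of_isIso {X Y : A} (hY : ExtPerp T Y) (f : X ⟶ Y) [IsIso f] : ExtPerp T X :=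
  hY.of_retract f (inv f) (by simp)

end ExtPerp

end ExtPerp

section DerivedVanishing

variable {A : Type u} [Category.{v} A] [Abelian A]

/-- The stupid truncation of a cochain complex in degrees `≥ k`, as a subcomplex. -/
noncomputable def stupidGE (Y : CochainComplex A ℤ) (k : ℤ) : CochainComplex A ℤ where
  X i := kernel (if i < k then 𝟙 (Y.X i) else 0)
  d i j := kernel.lift _ (kernel.ι _ ≫ Y.d i j) (by
    by_cases hj : j < k
    · by_cases hij : i + 1 = j
      · have h : kernel.ι (if i < k then 𝟙 (Y.X i) else 0) = 0 := by
          simpa [show i < k by lia] using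
            kernel.condition (if i < k then 𝟙 (Y.X i) else 0)
        simp [h]
      · simp [Y.shape i j hij]
    · simp [hj])
  shape i j hij := by
    rw [← cancel_mono (kernel.ι _)]
    simp [Y.shape i j hij]
  d_comp_d' i j k _ _ := by
    rw [← cancel_mono (kernel.ι _)]
    simp

/-- The inclusion of the stupid truncation in degrees `≥ k`. -/
noncomputable def stupidGEι (Y : CochainComplex A ℤ) (k : ℤ) : stupidGE Y k ⟶ Y where
  f i := kernel.ι (if i < k then 𝟙 (Y.X i) else 0)
  comm' i j _ := by simp [stupidGE]

instance (Y : CochainComplex A ℤ) (k i : ℤ) : Mono ((stupidGEι Y k).f i) :=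
  inferInstanceAs (Mono (kernel.ι (if i < k then 𝟙 (Y.X i) else 0)))

instance (Y : CochainComplex A ℤ) (k : ℤ) : Mono (stupidGEι Y k) :=
  HomologicalComplex.mono_of_mono_f _ inferInstance

lemma isZero_stupidGE_X (Y : CochainComplex A ℤ) {k i : ℤ} (h : i < k) :
    IsZero ((stupidGE Y k).X i) := by
  rw [IsZero.iff_id_eq_zero, ← cancel_mono ((stupidGEι Y k).f i), zero_comp, Category.id_comp]
  have h' : (stupidGEι Y k).f i ≫ (if i < k then 𝟙 (Y.X i) else 0) = 0 := kernel.condition _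
  rwa [if_pos h, Category.comp_id] at h'

lemma isIso_stupidGEι_f (Y : CochainComplex A ℤ) {k i : ℤ} (h : k ≤ i) :
    IsIso ((stupidGEι Y k).f i) := by
  have : ¬ i < k := by lia
  obtain ⟨r, hr⟩ : ∃ r : Y.X i ⟶ (stupidGE Y k).X i, r ≫ (stupidGEι Y k).f i = 𝟙 (Y.X i) :=
    ⟨kernel.lift (if i < k then 𝟙 (Y.X i) else 0) (𝟙 (Y.X i)) (by simp [this]),
      kernel.lift_ι _ _ _⟩
  refine ⟨r, ?_, hr⟩
  rw [← cancel_mono ((stupidGEι Y k).f i), Category.assoc, hr, Category.id_comp,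
    Category.comp_id]

/-- The short exact sequence of complexes given by the stupid truncation. -/
noncomputable abbrev stupidSES (Y : CochainComplex A ℤ) (k : ℤ) :
    ShortComplex (CochainComplex A ℤ) :=
  ShortComplex.mk (stupidGEι Y k) (cokernel.π _) (cokernel.condition _)

lemma stupidSES_shortExact (Y : CochainComplex A ℤ) (k : ℤ) : (stupidSES Y k).ShortExact where
  exact := ShortComplex.exact_cokernel _

lemma stupidSES_shortExact_eval (Y : CochainComplex A ℤ) (k i : ℤ) :
    ((stupidSES Y k).map (HomologicalComplex.eval A _ i)).ShortExact :=
  (HomologicalComplex.shortExact_iff_degreewise_shortExact _).1 (stupidSES_shortExact Y k) i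

lemma isZero_stupidSES_X₃_X (Y : CochainComplex A ℤ) {k i : ℤ} (h : k ≤ i) :
    IsZero ((stupidSES Y k).X₃.X i) :=
  (stupidSES_shortExact_eval Y k i).isIso_f_iff.1 (isIso_stupidGEι_f Y h)

lemma isIso_stupidSES_g_f (Y : CochainComplex A ℤ) {k i : ℤ} (h : i < k) :
    IsIso ((stupidSES Y k).g.f i) :=
  (stupidSES_shortExact_eval Y k i).isIso_g_iff.2 (isZero_stupidGE_X Y h)

section

variable [HasExt.{w} A] {T : A}

lemma ExtPerp.stupidGE_X {Y : CochainComplex A ℤ} (hY : ∀ j, ExtPerp T (Y.X j)) (k j : ℤ) :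
    ExtPerp T ((stupidGE Y k).X j) := by
  by_cases h : j < k
  · exact .of_isZero (isZero_stupidGE_X Y h)
  · have := isIso_stupidGEι_f Y (not_lt.1 h)
    exact (hY j).of_isIso ((stupidGEι Y k).f j)

lemma ExtPerp.stupidSES_X₃_X {Y : CochainComplex A ℤ} (hY : ∀ j, ExtPerp T (Y.X j)) (k j : ℤ) :
    ExtPerp T ((stupidSES Y k).X₃.X j) := by
  by_cases h : j < k
  · have := isIso_stupidSES_g_f Y h
    exact (hY j).of_isIso (inv ((stupidSES Y k).g.f j))
  · exact .of_isZero (isZero_stupidSES_X₃_X Y (not_lt.1 h))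

end

variable [HasDerivedCategory.{w'} A]

lemma exists_lift_stupidGEι (Y : CochainComplex A ℤ) (k : ℤ) {X : DerivedCategory A}
    (φ : X ⟶ Q.obj Y) (h : φ ≫ Q.map (stupidSES Y k).g = 0) :
    ∃ ψ : X ⟶ Q.obj (stupidGE Y k), φ = ψ ≫ Q.map (stupidGEι Y k) :=
  Pretriangulated.Triangle.coyoneda_exact₂ _
    (triangleOfSES_distinguished (stupidSES_shortExact Y k)) φ h

lemma isIso_of_isIso_Q_map_singleFunctor {X : CochainComplex A ℤ} {k : ℤ} [X.IsStrictlyGE k]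
    [X.IsStrictlyLE k] {B : A} (s : X ⟶ (CochainComplex.singleFunctor A k).obj B)
    [IsIso (Q.map s)] : IsIso s := by
  obtain ⟨A₀, ⟨e⟩⟩ : ∃ A₀, Nonempty (X ≅ (CochainComplex.singleFunctor A k).obj A₀) :=
    X.exists_iso_single k
  have ⟨φ, hφ⟩ := (CochainComplex.singleFunctor A k).map_surjective (e.inv ≫ s)
  have : IsIso ((singleFunctor A k).map φ) := by
    change IsIso (Q.map ((CochainComplex.singleFunctor A k).map φ))
    rw [hφ, Functor.map_comp]
    infer_instance
  have : IsIso φ := (NatIso.isIso_map_iff (singleFunctorCompHomologyFunctorIso A k) φ).1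
    (by dsimp; infer_instance)
  have : IsIso (e.inv ≫ s) := by rw [← hφ]; infer_instance
  exact IsIso.of_isIso_comp_left e.inv s

lemma Q_map_eq_zero_of_lift {T : A} {Y : CochainComplex A ℤ}
    (hY : ∀ a : T ⟶ Y.X 0, a ≫ Y.d 0 1 = 0 → ∃ b : T ⟶ Y.X (-1), b ≫ Y.d (-1) 0 = a)
    (g : (CochainComplex.singleFunctor A 0).obj T ⟶ Y) : Q.map g = 0 := by
  obtain ⟨a, ha⟩ := CochainComplex.HomComplex.Cochain.fromSingleMk_surjective
    (CochainComplex.HomComplex.Cochain.ofHom g) 0 (add_zero 0)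
  have ha' : CochainComplex.HomComplex.Cochain.fromSingleMk (a ≫ Y.d 0 1) (zero_add 1) = 0 := by
    rw [← CochainComplex.HomComplex.Cochain.δ_fromSingleMk a (add_zero 0), ha]
    simp
  obtain ⟨b, rfl⟩ := hY a (by
    simpa only [CochainComplex.HomComplex.Cochain.fromSingleEquiv_fromSingleMk, map_zero] using
      congrArg (CochainComplex.HomComplex.Cochain.fromSingleEquiv (zero_add 1)) ha')
  have : Homotopy g 0 := (CochainComplex.HomComplex.Cochain.equivHomotopy g 0).symm
    ⟨CochainComplex.HomComplex.Cochain.fromSingleMk b (by lia), by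
      rw [CochainComplex.HomComplex.Cochain.δ_fromSingleMk _ _ 0 0 (by lia), ha]
      simp⟩
  rw [Q_map_eq_of_homotopy _ this, Q.map_zero]

variable [HasExt.{w} A]

lemma hom_singleFunctor_eq_zero {T B : A} {a : ℤ} (m : ℕ) (hm : (m : ℤ) + a = 0)
    (h : Subsingleton (Ext T B m))
    (φ : (singleFunctor A 0).obj T ⟶ (singleFunctor A a).obj B) : φ = 0 := by
  have h' : Subsingleton (ShiftedHom ((singleFunctor A 0).obj T)
      ((singleFunctor A 0).obj B) (m : ℤ)) := Ext.homEquiv.symm.subsingleton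
  rw [← cancel_mono (((singleFunctors A).shiftIso (m : ℤ) a 0 hm).inv.app B)]
  exact h'.elim _ _

variable {T : A} {n : ℕ}

lemma hom_Q_eq_zero_of_isStrictlyLE (hi : ∀ i : ℕ, n < i → ∀ X : A, Subsingleton (Ext T X i))
    (Y : CochainComplex A ℤ) (hY : ∀ i : ℤ, -(n : ℤ) ≤ i → IsZero (Y.X i))
    (φ : (singleFunctor A 0).obj T ⟶ Q.obj Y) : φ = 0 := by
  change Q.obj ((CochainComplex.singleFunctor A 0).obj T) ⟶ Q.obj Y at φ
  obtain ⟨K, s, _, g, rfl⟩ := right_fac φ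
  have hK (i : ℤ) (hi : i ≠ 0) : IsZero (K.homology i) := by
    have e := asIso ((DerivedCategory.homologyFunctor A i).map (Q.map s))
    have e' := (homologyFunctorFactors A i).app K
    have e'' := (homologyFunctorFactors A i).app ((CochainComplex.singleFunctor A 0).obj T)
    refine IsZero.of_iso ?_ (e'.symm ≪≫ e ≪≫ e'')
    exact HomologicalComplex.isZero_single_obj_homology _ _ _ _ hi
  let S := stupidSES K (-n)
  have hS := stupidSES_shortExact K (-n)
  have hg : stupidGEι K (-n) ≫ g = 0 := by
    ext i
    by_cases hi : -(n : ℤ) ≤ i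
    · exact (hY i hi).eq_of_tgt _ _
    · exact (isZero_stupidGE_X K (by lia)).eq_of_src _ _
  have fac : S.g ≫ cokernel.desc _ g hg = g := cokernel.π_desc _ _ _
  have hLE : S.X₃.IsLE (-n - 1) := by
    have : S.X₃.IsStrictlyLE (-n - 1) := by
      rw [CochainComplex.isStrictlyLE_iff]
      exact fun i hi ↦ isZero_stupidSES_X₃_X K (by lia)
    infer_instance
  have hGE : S.X₃.IsGE (-n - 1) := by
    rw [CochainComplex.isGE_iff]
    intro i hi
    rw [HomologicalComplex.exactAt_iff_isZero_homology]
    refine (hS.homology_exact₃ i (i + 1) rfl).isZero_of_both_zeros ?_ ?_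
    · exact (hK i (by lia)).eq_of_src _ _
    · refine IsZero.eq_of_tgt (ShortComplex.isZero_homology_of_isZero_X₂ _ ?_) _ _
      exact isZero_stupidGE_X K (by lia)
  obtain ⟨B, ⟨e⟩⟩ := exists_iso_singleFunctor_obj_of_isGE_of_isLE (Q.obj S.X₃) (-n - 1)
  have h0 : inv (Q.map s) ≫ Q.map S.g ≫ e.hom = 0 :=
    hom_singleFunctor_eq_zero (n + 1) (by push_cast; ring) (hi _ (by lia) _) _
  rw [← fac, Q.map_comp]
  have : inv (Q.map s) ≫ Q.map S.g = 0 := by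
    rw [← cancel_mono e.hom]; simpa using h0
  rw [reassoc_of% this, zero_comp]
  rfl

lemma hom_Q_eq_zero_of_extPerp (hi : ∀ i : ℕ, n < i → ∀ X : A, Subsingleton (Ext T X i))
    (m : ℕ) (Y : CochainComplex A ℤ) (hY : ∀ j, ExtPerp T (Y.X j))
    (hY' : ∀ i : ℤ, m - (n : ℤ) ≤ i → IsZero (Y.X i)) (hm : m ≤ n)
    (φ : (singleFunctor A 0).obj T ⟶ Q.obj Y) : φ = 0 := by
  induction m generalizing Y with
  | zero => exact hom_Q_eq_zero_of_isStrictlyLE hi Y (fun i hi ↦ hY' i (by simpa using hi)) φ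
  | succ m IH =>
    have h0 := IH _ (ExtPerp.stupidSES_X₃_X hY (m - n)) (fun i hi ↦ isZero_stupidSES_X₃_X Y hi)
      (by lia) (φ ≫ Q.map (stupidSES Y (m - n)).g)
    obtain ⟨ψ, rfl⟩ := exists_lift_stupidGEι Y _ φ h0
    have : (stupidGE Y (m - n)).IsStrictlyGE (m - n) := by
      rw [CochainComplex.isStrictlyGE_iff]
      exact fun i hi ↦ isZero_stupidGE_X Y hi
    have : (stupidGE Y (m - n)).IsStrictlyLE (m - n) := by
      rw [CochainComplex.isStrictlyLE_iff]
      intro i hi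
      have := isIso_stupidGEι_f Y hi.le
      exact (hY' i (by push_cast; lia)).of_iso (asIso ((stupidGEι Y (m - n)).f i))
    obtain ⟨B, ⟨e⟩⟩ := CochainComplex.exists_iso_single (stupidGE Y (m - n)) (m - n)
    let e₁ : (stupidGE Y (m - n)).X (m - n) ≅ B :=
      (HomologicalComplex.eval A _ (m - n : ℤ)).mapIso e ≪≫
        HomologicalComplex.singleObjXSelf (.up ℤ) (m - n : ℤ) B
    have hB : ExtPerp T B := (ExtPerp.stupidGE_X hY (m - n) (m - n)).of_isIso e₁.inv
    have hψ : ψ ≫ Q.map e.hom = 0 := hom_singleFunctor_eq_zero (n - m) (by lia)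
      (hB _ (by lia)) _
    have : ψ = 0 := by rw [← cancel_mono (Q.map e.hom), hψ, zero_comp]
    rw [this, zero_comp]

lemma hom_Q_eq_zero (hi : ∀ i : ℕ, n < i → ∀ X : A, Subsingleton (Ext T X i))
    (Y : CochainComplex A ℤ) (hY : ∀ j, ExtPerp T (Y.X j))
    (hY' : ∀ a : T ⟶ Y.X 0, a ≫ Y.d 0 1 = 0 → ∃ b : T ⟶ Y.X (-1), b ≫ Y.d (-1) 0 = a)
    (φ : (singleFunctor A 0).obj T ⟶ Q.obj Y) : φ = 0 := by
  obtain ⟨ψ, rfl⟩ := exists_lift_stupidGEι Y 0 φ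
    (hom_Q_eq_zero_of_extPerp hi n _ (ExtPerp.stupidSES_X₃_X hY 0)
      (fun i hi ↦ isZero_stupidSES_X₃_X Y (by lia)) le_rfl _)
  change Q.obj ((CochainComplex.singleFunctor A 0).obj T) ⟶ _ at ψ
  have : (stupidGE Y 0).IsStrictlyGE 0 := by
    rw [CochainComplex.isStrictlyGE_iff]
    exact fun i hi ↦ isZero_stupidGE_X Y hi
  obtain ⟨X, _, _, s, _, g, rfl⟩ := right_fac_of_isStrictlyLE_of_isStrictlyGE 0 0 ψ
  have := isIso_of_isIso_Q_map_singleFunctor s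
  have h : Q.map g ≫ Q.map (stupidGEι Y 0) = 0 := by
    simpa using Q_map_eq_zero_of_lift hY' (inv s ≫ g ≫ stupidGEι Y 0)
  exact (Category.assoc _ _ _).trans ((congrArg (inv (Q.map s) ≫ ·) h).trans comp_zero)

lemma hom_Q_shift_eq_zero (hi : ∀ i : ℕ, n < i → ∀ X : A, Subsingleton (Ext T X i))
    (Y : CochainComplex A ℤ) (hY : ∀ j, ExtPerp T (Y.X j))
    (hY' : ∀ {p q r : ℤ}, p + 1 = q → q + 1 = r → ∀ a : T ⟶ Y.X q, a ≫ Y.d q r = 0 →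
      ∃ b : T ⟶ Y.X p, b ≫ Y.d p q = a)
    (i : ℤ) (φ : (singleFunctor A 0).obj T ⟶ (Q.obj Y)⟦i⟧) : φ = 0 := by
  rw [← cancel_mono ((Q.commShiftIso i).inv.app Y), zero_comp]
  refine hom_Q_eq_zero hi (Y⟦i⟧) (fun j ↦ hY _) (fun a ha ↦ ?_) _
  replace ha : (show T ⟶ Y.X (0 + i) from a) ≫ (i.negOnePow • Y.d (0 + i) (1 + i)) = 0 := ha
  obtain ⟨b, hb⟩ := hY' (p := -1 + i) (q := 0 + i) (r := 1 + i) (by lia) (by lia) a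
    (by rwa [Linear.comp_units_smul, smul_eq_zero_iff_eq] at ha)
  suffices (i.negOnePow • b) ≫ (i.negOnePow • Y.d (-1 + i) (0 + i)) = a from ⟨_, this⟩
  rw [Linear.comp_units_smul, Linear.units_smul_comp, smul_smul, Int.units_mul_self, one_smul, hb]

end DerivedVanishing

section CanonicalEpi

variable {A : Type u} [Category.{v} A]

section

variable [HasCoproducts.{v} A]

/-- The coproduct of copies of `T` indexed by the morphisms from `T` to `E`. -/
noncomputable abbrev homCopower (T E : A) : A := ∐ (fun _ : (T ⟶ E) ↦ T)

/-- The canonical morphism to `E` from the coproduct of copies of `T` indexed by `T ⟶ E`. -/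
noncomputable def canon (T E : A) : homCopower T E ⟶ E := Sigma.desc (fun φ ↦ φ)

lemma exists_lift_canon {T E : A} (a : T ⟶ E) : ∃ b : T ⟶ homCopower T E, b ≫ canon T E = a :=
  ⟨Sigma.ι (fun _ : (T ⟶ E) ↦ T) a, by simp [canon]⟩

end

variable [Abelian A] [HasCoproducts.{v} A]

/-- The chain complex `⋯ → P₁ → P₀ → E` obtained by iterating `canon` on kernels. -/
noncomputable def canonResolution (T E : A) : ChainComplex A ℕ :=
  ChainComplex.mk' E (homCopower T E) (canon T E)
    (fun f ↦ ⟨homCopower T (kernel f), canon T (kernel f) ≫ kernel.ι f, by simp⟩)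

lemma canonResolution_d_one_zero (T E : A) : (canonResolution T E).d 1 0 = canon T E :=
  ChainComplex.mk'_d_1_0 ..

/-- The terms of `canonResolution` in degrees at least two. -/
noncomputable def canonResolutionXIso (T E : A) (m : ℕ) :
    (canonResolution T E).X (m + 2) ≅ homCopower T (kernel ((canonResolution T E).d (m + 1) m)) :=
  ChainComplex.mk'XIso ..

lemma canonResolution_d (T E : A) (m : ℕ) :
    (canonResolution T E).d (m + 2) (m + 1) = (canonResolutionXIso T E m).hom ≫
      canon T (kernel ((canonResolution T E).d (m + 1) m)) ≫
        kernel.ι ((canonResolution T E).d (m + 1) m) :=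
  ChainComplex.mk'_d ..

lemma exists_lift_canonResolution_zero {T E : A} (a : T ⟶ (canonResolution T E).X 0) :
    ∃ b, b ≫ (canonResolution T E).d 1 0 = a := by
  rw [canonResolution_d_one_zero]
  exact exists_lift_canon a

lemma exists_lift_canonResolution_succ {T E : A} {m : ℕ} (a : T ⟶ (canonResolution T E).X (m + 1))
    (ha : a ≫ (canonResolution T E).d (m + 1) m = 0) :
    ∃ b, b ≫ (canonResolution T E).d (m + 2) (m + 1) = a := by
  obtain ⟨b, hb⟩ := exists_lift_canon (kernel.lift _ a ha)
  refine ⟨b ≫ (canonResolutionXIso T E m).inv, ?_⟩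
  simp [canonResolution_d, reassoc_of% hb]

/-- `canonResolution` as a cochain complex in nonpositive degrees. -/
noncomputable def canonCochain (T E : A) : CochainComplex A ℤ :=
  (canonResolution T E).extend ComplexShape.embeddingDownNat

/-- The terms of `canonCochain`. -/
noncomputable def canonCochainXIso (T E : A) (m : ℕ) {q : ℤ} (h : -(m : ℤ) = q) :
    (canonCochain T E).X q ≅ (canonResolution T E).X m :=
  (canonResolution T E).extendXIso ComplexShape.embeddingDownNat h

lemma canonCochain_d (T E : A) (m m' : ℕ) {q q' : ℤ} (h : -(m : ℤ) = q) (h' : -(m' : ℤ) = q') :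
    (canonCochain T E).d q q' = (canonCochainXIso T E m h).hom ≫ (canonResolution T E).d m m' ≫
      (canonCochainXIso T E m' h').inv :=
  (canonResolution T E).extend_d_eq ComplexShape.embeddingDownNat h h'

lemma isZero_canonCochain_X (T E : A) {q : ℤ} (h : 0 < q) : IsZero ((canonCochain T E).X q) :=
  (canonResolution T E).isZero_extend_X _ _ (fun m hm ↦ by
    change -(m : ℤ) = q at hm
    lia)

lemma exists_lift_canonCochain {T E : A} {p q r : ℤ} (hp : p + 1 = q) (hr : q + 1 = r)
    (a : T ⟶ (canonCochain T E).X q) (ha : a ≫ (canonCochain T E).d q r = 0) :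
    ∃ b, b ≫ (canonCochain T E).d p q = a := by
  obtain hq | hq := lt_or_ge 0 q
  · exact ⟨0, (isZero_canonCochain_X T E hq).eq_of_tgt _ _⟩
  obtain ⟨m, rfl⟩ : ∃ m : ℕ, -(m : ℤ) = q := ⟨q.natAbs, by lia⟩
  suffices ∃ b, b ≫ (canonResolution T E).d (m + 1) m =
      a ≫ (canonCochainXIso T E m rfl).hom by
    obtain ⟨b, hb⟩ := this
    have hp' : -((m + 1 : ℕ) : ℤ) = p := by lia
    refine ⟨b ≫ (canonCochainXIso T E (m + 1) hp').inv, ?_⟩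
    simp [canonCochain_d T E (m + 1) m hp' rfl, reassoc_of% hb]
  obtain _ | m := m
  · exact exists_lift_canonResolution_zero _
  · refine exists_lift_canonResolution_succ _ ?_
    have hr' : -(m : ℤ) = r := by lia
    rw [canonCochain_d T E (m + 1) m rfl hr'] at ha
    rw [← cancel_mono (canonCochainXIso T E m hr').inv]
    simpa using ha

lemma epi_canon_of_isZero_homology {T E : A} (h : IsZero ((canonCochain T E).homology 0)) :
    Epi (canon T E) := by
  rw [← HomologicalComplex.exactAt_iff_isZero_homology,
    HomologicalComplex.exactAt_iff' _ (-1) 0 1 (by simp) (by simp)] at h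
  have := h.epi_f ((isZero_canonCochain_X T E zero_lt_one).eq_of_tgt _ _)
  change Epi ((canonCochain T E).d (-1) 0) at this
  rw [canonCochain_d T E 1 0 (by simp) (by simp), epi_comp_iff_of_epi, epi_comp_iff_of_isIso,
    canonResolution_d_one_zero] at this
  exact this

variable [HasExt.{w} A]

/-- The coproducts of copies of `T` are right `Ext`-orthogonal to `T` in positive degrees. -/
def IsSigmaRigid (T : A) : Prop :=
  ∀ I : Type v, ExtPerp T (∐ (fun _ : I ↦ T))

lemma ExtPerp.canonResolution_X {T E : A} (hii : IsSigmaRigid T) (hE : ExtPerp T E) (m : ℕ) :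
    ExtPerp T ((canonResolution T E).X m) := by
  match m with
  | 0 => exact hE
  | 1 => exact hii _
  | m + 2 => exact (hii _).of_isIso (canonResolutionXIso T E m).hom

lemma ExtPerp.canonCochain_X {T E : A} (hii : IsSigmaRigid T) (hE : ExtPerp T E) (q : ℤ) :
    ExtPerp T ((canonCochain T E).X q) := by
  obtain hq | hq := lt_or_ge 0 q
  · exact .of_isZero (isZero_canonCochain_X T E hq)
  · obtain ⟨m, rfl⟩ : ∃ m : ℕ, -(m : ℤ) = q := ⟨q.natAbs, by lia⟩
    exact (hE.canonResolution_X hii m).of_isIso (canonCochainXIso T E m rfl).hom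

variable [HasDerivedCategory.{w'} A] {T : A} {n : ℕ}

lemma epi_canon (hi : ∀ i : ℕ, n < i → ∀ X : A, Subsingleton (Ext T X i)) (hii : IsSigmaRigid T)
    (hiii : ∀ X : CochainComplex A ℤ,
      (∀ (i : ℤ) (φ : (singleFunctor A 0).obj T ⟶ (Q.obj X)⟦i⟧), φ = 0) →
        ∀ m : ℤ, IsZero (X.homology m))
    {E : A} (hE : ExtPerp T E) : Epi (canon T E) :=
  epi_canon_of_isZero_homology <| hiii _ (hom_Q_shift_eq_zero hi _ (hE.canonCochain_X hii)
    exists_lift_canonCochain) 0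

end CanonicalEpi

section ShortExact

variable {A : Type u} [Category.{v} A] [Abelian A]

lemma shortExact_cokernel {X Y : A} (f : X ⟶ Y) [Mono f] :
    (ShortComplex.mk f (cokernel.π f) (cokernel.condition f)).ShortExact where
  exact := ShortComplex.exact_cokernel f

lemma shortExact_kernel {X Y : A} (g : X ⟶ Y) [Epi g] :
    (ShortComplex.mk (kernel.ι g) g (kernel.condition g)).ShortExact where
  exact := ShortComplex.exact_kernel g

lemma shortExact_of_isPullback_g {S : ShortComplex A} (hS : S.ShortExact) {P M : A}
    {a : P ⟶ S.X₂} {b : P ⟶ M} {q : M ⟶ S.X₃} (h : IsPullback a b S.g q) :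
    ∃ (f : S.X₁ ⟶ P) (w : f ≫ b = 0), (ShortComplex.mk f b w).ShortExact := by
  have := hS.mono_f
  have := hS.epi_g
  obtain ⟨f, hf, hf'⟩ : ∃ f : S.X₁ ⟶ P, f ≫ a = S.f ∧ f ≫ b = 0 :=
    ⟨h.lift S.f 0 (by simp), h.lift_fst _ _ _, h.lift_snd _ _ _⟩
  have : Mono f := mono_of_mono_fac hf
  have : Epi b := Abelian.epi_snd_of_isLimit _ _ h.isLimit
  refine ⟨f, hf', .mk' (ShortComplex.exact_of_f_is_kernel _
    (KernelFork.IsLimit.ofι' _ _ fun {W} k hk ↦ ?_)) ‹_› ‹_›⟩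
  have hk' : (k ≫ a) ≫ S.g = 0 := by simp [h.w, reassoc_of% hk]
  exact ⟨hS.exact.lift _ hk', h.hom_ext (by simp [hf]) (by simpa [hf'] using hk.symm)⟩

lemma shortExact_of_isPullback_f {S : ShortComplex A} (hS : S.ShortExact) {Q Z : A}
    {a : Q ⟶ S.X₁} {b : Q ⟶ Z} {c : Z ⟶ S.X₂} [Epi c] (h : IsPullback a b S.f c) :
    ∃ w : b ≫ c ≫ S.g = 0, (ShortComplex.mk b (c ≫ S.g) w).ShortExact := by
  have := hS.mono_f
  have := hS.epi_g
  have : Mono b := h.mono_snd_of_mono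
  refine ⟨by rw [← reassoc_of% h.w, S.zero, comp_zero], .mk' (ShortComplex.exact_of_f_is_kernel _
    (KernelFork.IsLimit.ofι' _ _ fun {W} k hk ↦ ?_)) ‹_› (epi_comp _ _)⟩
  have hk' : (k ≫ c) ≫ S.g = 0 := by simpa using hk
  exact ⟨h.lift (hS.exact.lift _ hk') k (by simp), by simp⟩

lemma exact_comp_mono {S : ShortComplex A} (hS : S.Exact) {Z : A} (f : S.X₃ ⟶ Z) [Mono f] :
    (ShortComplex.mk S.f (S.g ≫ f) (by simp)).Exact :=
  (ShortComplex.exact_iff_of_epi_of_isIso_of_mono (S₁ := S)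
    (S₂ := ShortComplex.mk S.f (S.g ≫ f) (by simp)) ⟨𝟙 S.X₁, 𝟙 S.X₂, f, by simp, by simp⟩).1 hS

lemma exact_epi_comp {S : ShortComplex A} (hS : S.Exact) {Z : A} (g : Z ⟶ S.X₁) [Epi g] :
    (ShortComplex.mk (g ≫ S.f) S.g (by simp)).Exact :=
  (ShortComplex.exact_iff_of_epi_of_isIso_of_mono
    (S₁ := ShortComplex.mk (g ≫ S.f) S.g (by simp)) (S₂ := S)
    ⟨g, 𝟙 S.X₂, 𝟙 S.X₃, by simp, by simp⟩).2 hS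

end ShortExact

section LongExact

variable {A : Type u} [Category.{v} A] [Abelian A] [HasExt.{w} A] {S : ShortComplex A}
  (hS : S.ShortExact) {P : A} {m : ℕ}

include hS

lemma subsingleton_ext_X₁ (h₂ : Subsingleton (Ext P S.X₂ (m + 1)))
    (h₃ : Subsingleton (Ext P S.X₃ m)) : Subsingleton (Ext P S.X₁ (m + 1)) := by
  refine subsingleton_of_forall_eq 0 fun x ↦ ?_
  obtain ⟨y, rfl⟩ := Ext.covariant_sequence_exact₁ P hS x (Subsingleton.elim _ _) rfl
  rw [Subsingleton.elim y 0, Ext.zero_comp]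

lemma subsingleton_ext_X₂ (h₁ : Subsingleton (Ext P S.X₁ m))
    (h₃ : Subsingleton (Ext P S.X₃ m)) : Subsingleton (Ext P S.X₂ m) := by
  refine subsingleton_of_forall_eq 0 fun x ↦ ?_
  obtain ⟨y, rfl⟩ := Ext.covariant_sequence_exact₂ P hS x (Subsingleton.elim _ _)
  rw [Subsingleton.elim y 0, Ext.zero_comp]

lemma subsingleton_ext_X₃ (h₁ : Subsingleton (Ext P S.X₁ (m + 1)))
    (h₂ : Subsingleton (Ext P S.X₂ m)) : Subsingleton (Ext P S.X₃ m) := by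
  refine subsingleton_of_forall_eq 0 fun x ↦ ?_
  obtain ⟨y, rfl⟩ := Ext.covariant_sequence_exact₃ P hS x rfl (Subsingleton.elim _ _)
  rw [Subsingleton.elim y 0, Ext.zero_comp]

lemma subsingleton_ext_one_X₁ (h₂ : Subsingleton (Ext P S.X₂ 1))
    (h : ∀ a : P ⟶ S.X₃, ∃ b, b ≫ S.g = a) : Subsingleton (Ext P S.X₁ 1) := by
  refine subsingleton_of_forall_eq 0 fun x ↦ ?_
  obtain ⟨y, rfl⟩ := Ext.covariant_sequence_exact₁ P hS x (Subsingleton.elim _ _) rfl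
  obtain ⟨a, rfl⟩ := Ext.homEquiv₀.symm.surjective y
  obtain ⟨b, rfl⟩ := h a
  rw [Ext.homEquiv₀_symm_apply, ← Ext.mk₀_comp_mk₀, Ext.comp_assoc_of_second_deg_zero,
    hS.comp_extClass, Ext.comp_zero]

lemma exists_lift_of_subsingleton_ext (h : Subsingleton (Ext P S.X₁ 1)) (a : P ⟶ S.X₃) :
    ∃ b, b ≫ S.g = a := by
  obtain ⟨y, hy⟩ := Ext.covariant_sequence_exact₃ P hS (Ext.mk₀ a) rfl (Subsingleton.elim _ _)
  obtain ⟨b, rfl⟩ := Ext.homEquiv₀.symm.surjective y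
  rw [Ext.homEquiv₀_symm_apply, Ext.mk₀_comp_mk₀] at hy
  exact ⟨b, Ext.homEquiv₀.symm.injective hy⟩

lemma subsingleton_ext_of_X₁_of_X₃ (h₁ : Subsingleton (Ext S.X₁ P m))
    (h₃ : Subsingleton (Ext S.X₃ P m)) : Subsingleton (Ext S.X₂ P m) := by
  refine subsingleton_of_forall_eq 0 fun x ↦ ?_
  obtain ⟨y, rfl⟩ := Ext.contravariant_sequence_exact₂ hS P x (Subsingleton.elim _ _)
  rw [Subsingleton.elim y 0, Ext.comp_zero]

lemma subsingleton_ext_of_X₂_of_X₃ (h₂ : Subsingleton (Ext S.X₂ P m))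
    (h₃ : Subsingleton (Ext S.X₃ P (m + 1))) : Subsingleton (Ext S.X₁ P m) := by
  refine subsingleton_of_forall_eq 0 fun x ↦ ?_
  obtain ⟨y, rfl⟩ := Ext.contravariant_sequence_exact₁ hS P x (add_comm 1 m)
    (Subsingleton.elim _ _)
  rw [Subsingleton.elim y 0, Ext.comp_zero]

lemma subsingleton_ext_one_of_exists_extension (h₂ : Subsingleton (Ext S.X₂ P 1))
    (h : ∀ a : S.X₁ ⟶ P, ∃ b, S.f ≫ b = a) : Subsingleton (Ext S.X₃ P 1) := by
  refine subsingleton_of_forall_eq 0 fun x ↦ ?_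
  obtain ⟨y, rfl⟩ := Ext.contravariant_sequence_exact₃ hS P x (Subsingleton.elim _ _)
    (add_zero 1)
  obtain ⟨a, rfl⟩ := Ext.homEquiv₀.symm.surjective y
  obtain ⟨b, rfl⟩ := h a
  rw [Ext.homEquiv₀_symm_apply, ← Ext.mk₀_comp_mk₀, hS.extClass_comp_assoc]

end LongExact

section Add

open ZeroObject

variable {A : Type u} [Category.{v} A] [Abelian A] [HasCoproducts.{v} A] {T : A}

lemma InAdd.coproduct (T : A) (I : Type v) : InAdd T (∐ fun _ : I ↦ T) :=
  ⟨I, 0, ⟨(isoBiprodZero (isZero_zero A)).symm⟩⟩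

lemma InAdd.of_section {X : A} {I : Type v} {g : (∐ fun _ : I ↦ T) ⟶ X} {s : X ⟶ ∐ fun _ : I ↦ T}
    (h : s ≫ g = 𝟙 X) : InAdd T X := by
  have : IsSplitEpi g := .mk' ⟨s, h⟩
  have hS := shortExact_kernel g
  let σ := ShortComplex.Splitting.ofExactOfSection _ hS.exact s h hS.mono_f
  exact ⟨I, kernel g, ⟨biprod.braiding _ _ ≪≫ σ.isoBinaryBiproduct.symm⟩⟩

lemma InAdd.exists_retract {X : A} (h : InAdd T X) :
    ∃ (I : Type v) (i : X ⟶ ∐ fun _ : I ↦ T) (p : (∐ fun _ : I ↦ T) ⟶ X), i ≫ p = 𝟙 X := by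
  obtain ⟨I, Y, ⟨e⟩⟩ := h
  exact ⟨I, biprod.inl ≫ e.hom, e.inv ≫ biprod.fst, by simp⟩

/-- `X` has a coresolution of length `m` by objects of `Add(T)`, built by short exact sequences. -/
inductive HasAddCoresolution (T : A) : ℕ → A → Prop
  | zero {X : A} (h : InAdd T X) : HasAddCoresolution T 0 X
  | succ {m : ℕ} {S : ShortComplex A} (hS : S.ShortExact) (h₂ : InAdd T S.X₂)
      (h₃ : HasAddCoresolution T m S.X₃) : HasAddCoresolution T (m + 1) S.X₁

lemma HasAddCoresolution.inLm {m : ℕ} {X : A} (h : HasAddCoresolution T m X) : InLm T m X := by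
  induction h with
  | @zero X h =>
    refine ⟨fun i ↦ Nat.casesOn i X (fun _ ↦ 0), 𝟙 X, 0, comp_zero, fun _ ↦ comp_zero,
      fun i hi ↦ ?_, fun i hi ↦ ?_, inferInstance, ?_, fun i ↦ ?_⟩
    · obtain rfl := Nat.le_zero.1 hi
      exact h
    · obtain _ | i := i
      · exact absurd hi (lt_irrefl _)
      · exact isZero_zero A
    · exact (ShortComplex.exact_iff_epi _ rfl).2 (inferInstanceAs (Epi (𝟙 X)))
    · exact ShortComplex.exact_of_isZero_X₂ _ (isZero_zero A)
  | @succ m S hS h₂ h₃ ih =>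
    obtain ⟨E, f, d, hw₀, hw, hE, hE', hf, hex₀, hex⟩ := ih
    have := hS.epi_g
    refine ⟨fun i ↦ Nat.casesOn i S.X₂ E, S.f, fun i ↦ Nat.casesOn i (S.g ≫ f) d,
      S.zero_assoc f |>.trans zero_comp, fun i ↦ ?_, fun i hi ↦ ?_, fun i hi ↦ ?_, hS.mono_f,
      exact_comp_mono hS.exact f, fun i ↦ ?_⟩
    · obtain _ | i := i
      · exact (Category.assoc _ _ _).trans ((congrArg _ hw₀).trans comp_zero)
      · exact hw i
    · obtain _ | i := i
      · exact h₂
      · exact hE i (by lia)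
    · obtain _ | i := i
      · lia
      · exact hE' i (by lia)
    · obtain _ | i := i
      · exact exact_epi_comp hex₀ S.g
      · exact hex i

end Add

section Approximation

variable {A : Type u} [Category.{v} A] [Abelian A] [HasExt.{w} A] {T : A}

lemma ExtPerp.of_injective (T : A) (I : A) [Injective I] : ExtPerp T I := by
  rintro (_ | i) hi
  · exact absurd hi (lt_irrefl 0)
  · exact Ext.subsingleton_of_injective T I i

lemma ExtPerp.cokernel {X Y : A} (hX : ExtPerp T X) (hY : ExtPerp T Y) (f : X ⟶ Y) [Mono f] :
    ExtPerp T (cokernel f) :=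
  fun i hi ↦ subsingleton_ext_X₃ (shortExact_cokernel f) (hX (i + 1) i.succ_pos) (hY i hi)

/-- The objects `X` such that `Ext¹(X, E) = 0` whenever `E` is right orthogonal to `T`. -/
def ExtOneLeftPerp (T X : A) : Prop := ∀ E : A, ExtPerp T E → Subsingleton (Ext X E 1)

lemma ExtOneLeftPerp.subsingleton_ext_two [EnoughInjectives A] {X : A} (hX : ExtOneLeftPerp T X)
    {E : A} (hE : ExtPerp T E) : Subsingleton (Ext X E 2) :=
  subsingleton_ext_X₁ (shortExact_cokernel (Injective.ι E)) (Ext.subsingleton_of_injective _ _ 1)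
    (hX _ (hE.cokernel (.of_injective T _) _))

lemma ExtOneLeftPerp.X₁ [EnoughInjectives A] {S : ShortComplex A} (hS : S.ShortExact)
    (h₂ : ExtOneLeftPerp T S.X₂) (h₃ : ExtOneLeftPerp T S.X₃) : ExtOneLeftPerp T S.X₁ :=
  fun E hE ↦ subsingleton_ext_of_X₂_of_X₃ hS (h₂ E hE) (h₃.subsingleton_ext_two hE)

lemma ExtOneLeftPerp.X₂ {S : ShortComplex A} (hS : S.ShortExact)
    (h₁ : ExtOneLeftPerp T S.X₁) (h₃ : ExtOneLeftPerp T S.X₃) : ExtOneLeftPerp T S.X₂ :=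
  fun E hE ↦ subsingleton_ext_of_X₁_of_X₃ hS (h₁ E hE) (h₃ E hE)

variable [HasCoproducts.{v} A]

lemma ExtOneLeftPerp.of_inAdd [EnoughInjectives A] {X : A} (hX : InAdd T X) :
    ExtOneLeftPerp T X := by
  intro E hE
  obtain ⟨I, s, r, hsr⟩ := hX.exists_retract
  refine subsingleton_ext_one_X₁ (shortExact_cokernel (Injective.ι E))
    (Ext.subsingleton_of_injective _ _ 0) fun a ↦ ?_
  choose b hb using fun j : I ↦ exists_lift_of_subsingleton_ext
    (shortExact_cokernel (Injective.ι E)) (hE 1 one_pos) (Sigma.ι (fun _ : I ↦ T) j ≫ r ≫ a)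
  have h : Sigma.desc b ≫ cokernel.π (Injective.ι E) = r ≫ a := by
    ext j
    simpa using hb j
  exact ⟨s ≫ Sigma.desc b, by simp [h, reassoc_of% hsr]⟩

lemma ExtOneLeftPerp.of_hasAddCoresolution [EnoughInjectives A] {m : ℕ} {X : A}
    (hX : HasAddCoresolution T m X) : ExtOneLeftPerp T X := by
  induction hX with
  | zero h => exact .of_inAdd h
  | succ hS h₂ _ ih => exact .X₁ hS (.of_inAdd h₂) ih

lemma ExtPerp.of_inAdd (hii : IsSigmaRigid T) {X : A} (hX : InAdd T X) : ExtPerp T X := by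
  obtain ⟨I, s, r, hsr⟩ := hX.exists_retract
  exact (hii I).of_retract s r hsr

lemma ExtPerp.kernel_canon (hii : IsSigmaRigid T) {E : A} (hE : ExtPerp T E) [Epi (canon T E)] :
    ExtPerp T (kernel (canon T E)) := by
  have hS := shortExact_kernel (canon T E)
  rintro (_ | _ | i) hi
  · exact absurd hi (lt_irrefl 0)
  · exact subsingleton_ext_one_X₁ hS (hii _ 1 one_pos) exists_lift_canon
  · exact subsingleton_ext_X₁ hS (hii _ _ hi) (hE _ i.succ_pos)

lemma ExtPerp.inAdd (hii : IsSigmaRigid T) {E : A} (hE : ExtPerp T E) [Epi (canon T E)]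
    (hE' : ExtOneLeftPerp T E) : InAdd T E := by
  obtain ⟨s, hs⟩ := exists_lift_of_subsingleton_ext (shortExact_kernel (canon T E))
    (hE' _ (hE.kernel_canon hii)) (𝟙 E)
  exact .of_section hs

variable (T) in
/-- `X` has a special preenvelope in the right orthogonal of `T`, with cokernel admitting an
`Add(T)`-coresolution of length `m`. -/
def HasSpecialPreenvelope (m : ℕ) (X : A) : Prop :=
  ∃ (P M : A) (i : X ⟶ P) (p : P ⟶ M) (w : i ≫ p = 0),
    (ShortComplex.mk i p w).ShortExact ∧ ExtPerp T P ∧ HasAddCoresolution T m M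

variable (T) in
/-- `X` has a special precover by an object admitting an `Add(T)`-coresolution of length `m`,
with kernel in the right orthogonal of `T`. -/
def HasSpecialPrecover (m : ℕ) (X : A) : Prop :=
  ∃ (K M : A) (i : K ⟶ M) (p : M ⟶ X) (w : i ≫ p = 0),
    (ShortComplex.mk i p w).ShortExact ∧ ExtPerp T K ∧ HasAddCoresolution T m M

lemma ExtPerp.hasSpecialPrecover (hii : IsSigmaRigid T) {E : A} (hE : ExtPerp T E)
    [Epi (canon T E)] : HasSpecialPrecover T 0 E :=
  ⟨_, _, _, _, _, shortExact_kernel (canon T E), hE.kernel_canon hii, .zero (.coproduct T _)⟩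

lemma HasSpecialPreenvelope.of_hasSpecialPrecover_cokernel {m : ℕ} {X I : A} [Injective I]
    (f : X ⟶ I) [Mono f] (h : HasSpecialPrecover T m (cokernel f)) :
    HasSpecialPreenvelope T m X := by
  obtain ⟨K, M, i, p, w, hS, hK, hM⟩ := h
  have sq := IsPullback.of_hasPullback (cokernel.π f) p
  obtain ⟨f', w', hS'⟩ := shortExact_of_isPullback_g (shortExact_cokernel f) sq
  obtain ⟨i', w'', hS''⟩ := shortExact_of_isPullback_g hS sq.flip
  exact ⟨_, M, f', _, w', hS', fun j hj ↦ subsingleton_ext_X₂ hS'' (hK j hj)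
    (ExtPerp.of_injective T I j hj), hM⟩

lemma HasSpecialPreenvelope.hasSpecialPrecover (hii : IsSigmaRigid T)
    (hT : ∀ E : A, ExtPerp T E → Epi (canon T E)) {m : ℕ} {X : A}
    (h : HasSpecialPreenvelope T m X) : HasSpecialPrecover T (m + 1) X := by
  obtain ⟨P, M, i, p, w, hS, hP, hM⟩ := h
  have := hT P hP
  have sq := IsPullback.of_hasPullback i (canon T P)
  obtain ⟨f', w', hS'⟩ := shortExact_of_isPullback_g (shortExact_kernel (canon T P)) sq.flip
  obtain ⟨w'', hS''⟩ := shortExact_of_isPullback_f hS sq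
  exact ⟨_, _, f', _, w', hS', hP.kernel_canon hii, .succ hS'' (.coproduct T _) hM⟩

variable [EnoughInjectives A]

lemma HasSpecialPreenvelope.of_forall_hasSpecialPrecover {m : ℕ}
    (h : ∀ X : A, (∀ i, m < i → Subsingleton (Ext T X i)) → HasSpecialPrecover T m X)
    {X : A} (hX : ∀ i, m + 1 < i → Subsingleton (Ext T X i)) : HasSpecialPreenvelope T m X :=
  .of_hasSpecialPrecover_cokernel (Injective.ι X) <| h _ fun i hi ↦
    subsingleton_ext_X₃ (shortExact_cokernel (Injective.ι X)) (hX (i + 1) (by lia))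
      (ExtPerp.of_injective T _ i (by lia))

lemma hasSpecialPrecover (hii : IsSigmaRigid T) (hT : ∀ E : A, ExtPerp T E → Epi (canon T E))
    (m : ℕ) (X : A) (hX : ∀ i, m < i → Subsingleton (Ext T X i)) : HasSpecialPrecover T m X := by
  induction m generalizing X with
  | zero =>
    have := hT X hX
    exact ExtPerp.hasSpecialPrecover hii hX
  | succ m ih =>
    exact (HasSpecialPreenvelope.of_forall_hasSpecialPrecover ih hX).hasSpecialPrecover hii hT

/-- Objects which are `Ext¹`-left orthogonal to the right orthogonal of `T` have an
`Add(T)`-coresolution. -/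
lemma ExtOneLeftPerp.hasAddCoresolution (hii : IsSigmaRigid T)
    (hT : ∀ E : A, ExtPerp T E → Epi (canon T E)) {n : ℕ} {X : A}
    (hn : ∀ i, n < i → Subsingleton (Ext T X i)) (hX : ExtOneLeftPerp T X) :
    HasAddCoresolution T n X := by
  obtain _ | n := n
  · have := hT X hn
    exact .zero (ExtPerp.inAdd hii hn hX)
  · obtain ⟨P, M, i, p, w, hS, hP, hM⟩ := HasSpecialPreenvelope.of_forall_hasSpecialPrecover
      (hasSpecialPrecover hii hT n) hn
    have := hT P hP
    exact .succ hS (hP.inAdd hii (.X₂ hS hX (.of_hasAddCoresolution hM))) hM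

lemma ExtOneLeftPerp.of_preenvelope {L T' : A} (hT' : InAdd T T') (f : L ⟶ T')
    (henv : ∀ E : A, ExtPerp T E → ∀ g : L ⟶ E, ∃ h : T' ⟶ E, f ≫ h = g) :
    ExtOneLeftPerp T L := by
  obtain ⟨h, hh⟩ := henv _ (.of_injective T _) (Injective.ι L)
  have : Mono f := mono_of_mono_fac hh
  have hS := shortExact_cokernel f
  exact .X₁ hS (.of_inAdd hT') fun E hE ↦
    subsingleton_ext_one_of_exists_extension hS (ExtOneLeftPerp.of_inAdd hT' E hE) (henv E hE)

end Approximation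

lemma enoughInjectives_of_isCoseparator {A : Type u} [Category.{v} A] [HasLimits A] {W : A}
    [Injective W] (hW : IsCoseparator W) : EnoughInjectives A where
  presentation X := by
    have := (isCoseparator_iff_mono W).1 hW X
    exact ⟨{ J := ∏ᶜ fun _ : (X ⟶ W) ↦ W, f := Pi.lift fun f : X ⟶ W ↦ f }⟩

end TiltingApproximation

/-- let `A` be a complete, cocomplete abelian category with an injective
cogenerator, and `T` an `n`-tilting object (conditions (i), (ii) and the generation
condition (iii)).  If `L` admits an `E`-preenvelope `f : L → T'` with `T' ∈ Add(T)`
(every morphism from `L` to an object of `E` factors through `f`), then `L` admits a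
finite `Add(T)`-coresolution of length `n`, i.e. `L ∈ L`. -/
theorem statement8 (A : Type u) [Category.{v} A] [Abelian A]
    [HasLimits A] [HasColimits A] [HasExt.{w} A] [HasDerivedCategory.{w'} A]
    (W : A) (hW : Injective W ∧ IsCoseparator W)
    (T : A) (n : ℕ)
    -- (i) projective dimension of `T` is at most `n`
    (hi : ∀ (i : ℕ), n < i → ∀ X : A, Subsingleton (Abelian.Ext T X i))
    -- (ii) no self-extensions against coproducts of copies of `T`
    (hii : ∀ (I : Type v) (i : ℕ), 0 < i →
      Subsingleton (Abelian.Ext T (∐ (fun _ : I => T)) i))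
    -- (iii) complexes right-orthogonal to `T` in all degrees are acyclic
    (hiii : ∀ X : CochainComplex A ℤ,
      (∀ (i : ℤ) (φ : (DerivedCategory.singleFunctor A 0).obj T ⟶
          (DerivedCategory.Q.obj X)⟦i⟧), φ = 0) →
      ∀ m : ℤ, IsZero (X.homology m))
    (L T' : A) (hT' : InAdd T T') (f : L ⟶ T')
    -- `f` is an `E`-preenvelope of `L`
    (henv : ∀ E : A, (∀ i : ℕ, 0 < i → Subsingleton (Abelian.Ext T E i)) →
      ∀ g : L ⟶ E, ∃ h : T' ⟶ E, f ≫ h = g) :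
    InLm T n L := by
  have := hW.1
  have := enoughInjectives_of_isCoseparator hW.2
  exact ((ExtOneLeftPerp.of_preenvelope hT' f henv).hasAddCoresolution hii
    (fun _ ↦ epi_canon hi hii hiii) (fun i h ↦ hi i h L)).inLm
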